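/- (Key bound (4.14) on the normal component.) Assume additionally A_θ, A_z ∈ C²(closure of E), u ∈ C²(closure of E; ℝ³), u = 0 on ∂E, that the Codazzi–Gauss identity ∂_z(A_{θ,z}/A_z) + ∂_θ(A_{z,θ}/A_θ) = −A_z A_θ κ_z κ_θ holds on E, that κ_θ, κ_z ≥ 0, and that the curvatures are comparable: with K_G = κ_θ κ_z one has (1/c)√K_G ≤ κ_θ, κ_z ≤ c√K_G on E for some c > 0. Then there exists a constant C > 0, depending only on c and the C² bounds of A_θ, A_z, such that ‖√K_G u_t‖²_{L²(E)} ≤ C ( ‖√K_G u_θ‖²_{L²(E)} + ‖√K_G u_z‖²_{L²(E)} + ‖|F^sym|‖²_{L²(E)} ). -/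

import Mathlib

open MeasureTheory Set Real

noncomputable section

/-- Partial derivative in `θ` of a scalar function on the parameter plane `(θ, z)`. -/
def dTh (f : ℝ × ℝ → ℝ) (p : ℝ × ℝ) : ℝ := fderiv ℝ f p (1, 0)

/-- Partial derivative in `z` of a scalar function on the parameter plane `(θ, z)`. -/
def dZ (f : ℝ × ℝ → ℝ) (p : ℝ × ℝ) : ℝ := fderiv ℝ f p (0, 1)

/-- The two-dimensional data: the functions `z1, z2` determining the parameter domain `E`,
the metric coefficients `Ath = A_θ`, `Az = A_z`, the principal curvatures `kth = κ_θ`,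
`kz = κ_z`, and the components `ut = u_t`, `uth = u_θ`, `uz = u_z` of a displacement. -/
structure Setup2D where
  z1 : ℝ → ℝ
  z2 : ℝ → ℝ
  Ath : ℝ × ℝ → ℝ
  Az : ℝ × ℝ → ℝ
  kth : ℝ × ℝ → ℝ
  kz : ℝ × ℝ → ℝ
  ut : ℝ × ℝ → ℝ
  uth : ℝ × ℝ → ℝ
  uz : ℝ × ℝ → ℝ

namespace Setup2D

/-- The parameter domain `E = {(θ,z) : θ ∈ (0,1), z ∈ (z1 θ, z2 θ)}`. -/
def E (S : Setup2D) : Set (ℝ × ℝ) :=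
  {p | p.1 ∈ Ioo (0 : ℝ) 1 ∧ p.2 ∈ Ioo (S.z1 p.1) (S.z2 p.1)}

/-- The entry `F₂₂` of the simplified gradient. -/
def F22 (S : Setup2D) (p : ℝ × ℝ) : ℝ :=
  (S.Az p * dTh S.uth p + S.Az p * S.Ath p * S.kth p * S.ut p + dZ S.Ath p * S.uz p) /
    (S.Az p * S.Ath p)

/-- The entry `F₂₃` of the simplified gradient. -/
def F23 (S : Setup2D) (p : ℝ × ℝ) : ℝ :=
  (S.Ath p * dZ S.uth p - dTh S.Az p * S.uz p) / (S.Az p * S.Ath p)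

/-- The entry `F₃₂` of the simplified gradient. -/
def F32 (S : Setup2D) (p : ℝ × ℝ) : ℝ :=
  (S.Az p * dTh S.uz p - dZ S.Ath p * S.uth p) / (S.Az p * S.Ath p)

/-- The entry `F₃₃` of the simplified gradient. -/
def F33 (S : Setup2D) (p : ℝ × ℝ) : ℝ :=
  (S.Ath p * dZ S.uz p + S.Az p * S.Ath p * S.kz p * S.ut p + dTh S.Az p * S.uth p) /
    (S.Az p * S.Ath p)

/-- `F₂₃^sym = (F₂₃ + F₃₂)/2`. -/
def F23sym (S : Setup2D) (p : ℝ × ℝ) : ℝ := (S.F23 p + S.F32 p) / 2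

/-- `|F^sym|² = F₂₂² + 2 (F₂₃^sym)² + F₃₃²`. -/
def FsymSq (S : Setup2D) (p : ℝ × ℝ) : ℝ := S.F22 p ^ 2 + 2 * S.F23sym p ^ 2 + S.F33 p ^ 2

/-- The weighted inner product `(f, g)_E = ∫_E A_θ A_z f g dθ dz`. -/
def ip (S : Setup2D) (f g : ℝ × ℝ → ℝ) : ℝ := ∫ p in S.E, S.Ath p * S.Az p * f p * g p

/-- The weighted squared norm `‖f‖²_E`. -/
def nsq (S : Setup2D) (f : ℝ × ℝ → ℝ) : ℝ := S.ip f f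

/-- The weighted squared norm `‖|F^sym|‖²_E` of the simplified symmetrized gradient. -/
def nF (S : Setup2D) : ℝ := ∫ p in S.E, S.Ath p * S.Az p * S.FsymSq p

/-- The standing context: the form of the domain, the regularity `A_θ, A_z, κ_θ, κ_z ∈ C¹`,
positivity of `A_θ, A_z` on the closure of `E`, and `u ∈ C¹`. -/
def Base (S : Setup2D) : Prop :=
  (∀ θ ∈ Icc (0 : ℝ) 1, 0 ≤ S.z1 θ ∧ S.z1 θ < S.z2 θ ∧ S.z2 θ ≤ 1) ∧
  ContDiff ℝ 1 S.Ath ∧ ContDiff ℝ 1 S.Az ∧ ContDiff ℝ 1 S.kth ∧ ContDiff ℝ 1 S.kz ∧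
  (∀ p ∈ closure S.E, 0 < S.Ath p ∧ 0 < S.Az p) ∧
  ContDiff ℝ 1 S.ut ∧ ContDiff ℝ 1 S.uth ∧ ContDiff ℝ 1 S.uz

/-- The boundary condition `u = 0` on `∂E`. -/
def BZero (S : Setup2D) : Prop := ∀ p ∈ frontier S.E, S.ut p = 0 ∧ S.uth p = 0 ∧ S.uz p = 0

/-- The additional `C²` regularity of `A_θ, A_z` and `u`. -/
def Csq (S : Setup2D) : Prop :=
  ContDiff ℝ 2 S.Ath ∧ ContDiff ℝ 2 S.Az ∧
  ContDiff ℝ 2 S.ut ∧ ContDiff ℝ 2 S.uth ∧ ContDiff ℝ 2 S.uz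

/-- The Codazzi–Gauss identity `∂_z(A_{θ,z}/A_z) + ∂_θ(A_{z,θ}/A_θ) = -A_z A_θ κ_z κ_θ`. -/
def CodazziGauss (S : Setup2D) : Prop :=
  ∀ p ∈ S.E,
    dZ (fun q => dZ S.Ath q / S.Az q) p + dTh (fun q => dTh S.Az q / S.Ath q) p =
      -(S.Az p * S.Ath p * S.kz p * S.kth p)

/-- The uniform bounds `a ≤ A_θ, A_z ≤ A` and `|∇A_θ| + |∇A_z| ≤ B` on the closure of `E`. -/
def Bounds (S : Setup2D) (a A B : ℝ) : Prop :=
  ∀ p ∈ closure S.E, a ≤ S.Ath p ∧ S.Ath p ≤ A ∧ a ≤ S.Az p ∧ S.Az p ≤ A ∧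
    ‖fderiv ℝ S.Ath p‖ + ‖fderiv ℝ S.Az p‖ ≤ B

/-- `ρ` satisfies `κ_z = ρ κ_θ` with `ρ₀ ≤ ρ ≤ ρ₁` and `|∇ρ| ≤ c2`. -/
def RhoHyp (S : Setup2D) (ρ : ℝ × ℝ → ℝ) (ρ0 ρ1 c2 : ℝ) : Prop :=
  ContDiff ℝ 1 ρ ∧ (∀ p ∈ S.E, S.kz p = ρ p * S.kth p) ∧
  (∀ p ∈ closure S.E, ρ0 ≤ ρ p ∧ ρ p ≤ ρ1 ∧ ‖fderiv ℝ ρ p‖ ≤ c2)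

/-- Nonnegativity of the curvatures and the comparability condition
`(1/c)√(κ_θ κ_z) ≤ κ_θ, κ_z ≤ c √(κ_θ κ_z)` on `E`. -/
def Comparable (S : Setup2D) (c : ℝ) : Prop :=
  ∀ p ∈ S.E, 0 ≤ S.kth p ∧ 0 ≤ S.kz p ∧
    c⁻¹ * Real.sqrt (S.kth p * S.kz p) ≤ S.kth p ∧
    S.kth p ≤ c * Real.sqrt (S.kth p * S.kz p) ∧
    c⁻¹ * Real.sqrt (S.kth p * S.kz p) ≤ S.kz p ∧
    S.kz p ≤ c * Real.sqrt (S.kth p * S.kz p)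

end Setup2D

/-- The points of a real set `s` at which `h` has a nonzero derivative, `h` vanishing on `s`,
form a countable set. -/
theorem countable_zero_of_hasDerivAt_ne_zero {s : Set ℝ} {h h' : ℝ → ℝ}
    (hd : ∀ x ∈ s, HasDerivAt h (h' x) x) (h0 : ∀ x ∈ s, h x = 0) :
    {x ∈ s | h' x ≠ 0}.Countable := by
  refine (countable_setOfPred_isolated_right_within (s := s)).mono ?_
  rintro x ⟨hx, hne⟩
  refine ⟨hx, ?_⟩
  have h1 : ∀ᶠ y in nhdsWithin x (s ∩ Ioi x), h y ≠ 0 :=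
    ((hd x hx).eventually_ne hne).filter_mono
      (nhdsWithin_mono x fun y hy => (ne_of_gt hy.2 : y ≠ x))
  have h2 : ∀ᶠ y in nhdsWithin x (s ∩ Ioi x), h y = 0 := by
    filter_upwards [self_mem_nhdsWithin] with y hy using h0 y hy.1
  rw [← Filter.empty_mem_iff_bot]
  filter_upwards [h1, h2] with y hy1 hy2 using hy1 hy2

/-- The integral over a bounded open real set of the derivative of a function vanishing on the
boundary is zero. -/
theorem setIntegral_deriv_eq_zero {O : Set ℝ} (hO : IsOpen O) (hb : Bornology.IsBounded O)
    {h h' : ℝ → ℝ} (hd : ∀ x ∈ closure O, HasDerivAt h (h' x) x)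
    (h0 : ∀ x ∈ frontier O, h x = 0) : ∫ x in O, h' x = 0 := by
  by_cases hi : IntegrableOn h' O
  swap
  · exact integral_undef hi
  obtain ⟨R, hR0, hR⟩ := hb.subset_ball_lt 0 0
  have hOR : O ⊆ Ioc (-R) R := fun x hx => by
    have := hR hx
    rw [Metric.mem_ball, Real.dist_eq, sub_zero, abs_lt] at this
    exact ⟨this.1, this.2.le⟩
  have hnot : ∀ y, R ≤ |y| → y ∉ O := fun y hy hyO => by
    have := hR hyO
    rw [Metric.mem_ball, Real.dist_eq, sub_zero] at this
    linarith
  have hcont : Continuous (O.indicator h) := by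
    refine continuous_indicator h0 fun x hx => ?_
    exact (hd x hx).continuousAt.continuousWithinAt
  have hcount := countable_zero_of_hasDerivAt_ne_zero
    (fun x hx => hd x (frontier_subset_closure hx)) h0
  have hderiv : ∀ x ∉ {x ∈ frontier O | h' x ≠ 0},
      HasDerivAt (O.indicator h) (O.indicator h' x) x := by
    intro x hx
    by_cases hxO : x ∈ O
    · rw [indicator_of_mem hxO]
      refine (hd x (subset_closure hxO)).congr_of_eventuallyEq ?_
      filter_upwards [hO.mem_nhds hxO] with y hy using indicator_of_mem hy h
    · rw [indicator_of_notMem hxO]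
      by_cases hxc : x ∈ closure O
      · have hxf : x ∈ frontier O := by rw [hO.frontier_eq]; exact ⟨hxc, hxO⟩
        have hz : h' x = 0 := by
          by_contra hne
          exact hx ⟨hxf, hne⟩
        have hdx := hd x hxc
        rw [hz, hasDerivAt_iff_isLittleO] at hdx
        rw [hasDerivAt_iff_isLittleO]
        refine (Asymptotics.isBigO_of_le _ fun y => ?_).trans_isLittleO hdx
        by_cases hy : y ∈ O <;> simp [hy, hxO, h0 x hxf]
      · refine (hasDerivAt_const x (0 : ℝ)).congr_of_eventuallyEq ?_
        filter_upwards [isClosed_closure.isOpen_compl.mem_nhds hxc] with y hy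
        exact indicator_of_notMem (fun hyO => hy (subset_closure hyO)) h
  have key := MeasureTheory.integral_eq_of_hasDerivAt_off_countable
    (O.indicator h) (O.indicator h') (a := -R) (b := R) hcount hcont.continuousOn
    (fun x hx => hderiv x hx.2)
    ((integrable_indicator_iff hO.measurableSet).2 hi).intervalIntegrable
  rw [intervalIntegral.integral_of_le (by linarith), setIntegral_indicator hO.measurableSet,
    inter_eq_self_of_subset_right hOR, indicator_of_notMem (hnot R (le_abs_self R)),
    indicator_of_notMem (hnot (-R) (by rw [abs_neg]; exact le_abs_self R)), sub_zero] at key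
  exact key

/-- The frontier of the preimage of an open set lies in the preimage of its frontier. -/
theorem preimage_frontier_subset_of_isOpen {α β : Type*} [TopologicalSpace α]
    [TopologicalSpace β] {U : Set β} (hU : IsOpen U) {φ : α → β} (hφ : Continuous φ) :
    frontier (φ ⁻¹' U) ⊆ φ ⁻¹' frontier U := by
  rw [(hU.preimage hφ).frontier_eq, hU.frontier_eq]
  exact fun x hx => ⟨hφ.closure_preimage_subset U hx.1, hx.2⟩

theorem continuousOn_fderiv_apply {s : Set (ℝ × ℝ)} {X : ℝ × ℝ → ℝ}
    (hX : ∀ p ∈ s, ContDiffAt ℝ 1 X p) (v : ℝ × ℝ) :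
    ContinuousOn (fun p => fderiv ℝ X p v) s := fun p hp =>
  (((hX p hp).continuousAt_fderiv one_ne_zero).clm_apply continuousAt_const).continuousWithinAt

theorem integrableOn_of_continuousOn_closure {U : Set (ℝ × ℝ)} (hb : Bornology.IsBounded U)
    {f : ℝ × ℝ → ℝ} (hf : ContinuousOn f (closure U)) : IntegrableOn f U :=
  (hf.integrableOn_compact hb.isCompact_closure).mono_set subset_closure

theorem setIntegral_dTh_eq_zero {U : Set (ℝ × ℝ)} (hU : IsOpen U) (hb : Bornology.IsBounded U)
    {X : ℝ × ℝ → ℝ} (hX : ∀ p ∈ closure U, ContDiffAt ℝ 1 X p)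
    (h0 : ∀ p ∈ frontier U, X p = 0) : ∫ p in U, dTh X p = 0 := by
  have hi : IntegrableOn (dTh X) U :=
    integrableOn_of_continuousOn_closure hb (continuousOn_fderiv_apply hX _)
  rw [← integral_indicator hU.measurableSet, Measure.volume_eq_prod, integral_prod_symm]
  swap
  · rw [← Measure.volume_eq_prod]; exact (integrable_indicator_iff hU.measurableSet).2 hi
  refine integral_eq_zero_of_ae (Filter.Eventually.of_forall fun z => ?_)
  have hφ : Continuous fun x : ℝ => (x, z) := by fun_prop
  have hV := hU.preimage hφ
  have hbV : Bornology.IsBounded ((fun x : ℝ => (x, z)) ⁻¹' U) :=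
    (LipschitzWith.prod_fst.isBounded_image hb).subset fun x hx => ⟨(x, z), hx, rfl⟩
  have := setIntegral_deriv_eq_zero hV hbV (h := fun x => X (x, z))
    (h' := fun x => dTh X (x, z)) (fun x hx => ?_)
    (fun x hx => h0 _ (preimage_frontier_subset_of_isOpen hU hφ hx))
  · rw [← integral_indicator hV.measurableSet] at this
    exact this
  · exact (((hX _ (hφ.closure_preimage_subset U hx)).differentiableAt
      one_ne_zero).hasFDerivAt).comp_hasDerivAt x
        ((hasDerivAt_id x).prodMk (hasDerivAt_const x z))

theorem setIntegral_dZ_eq_zero {U : Set (ℝ × ℝ)} (hU : IsOpen U) (hb : Bornology.IsBounded U)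
    {X : ℝ × ℝ → ℝ} (hX : ∀ p ∈ closure U, ContDiffAt ℝ 1 X p)
    (h0 : ∀ p ∈ frontier U, X p = 0) : ∫ p in U, dZ X p = 0 := by
  have hi : IntegrableOn (dZ X) U :=
    integrableOn_of_continuousOn_closure hb (continuousOn_fderiv_apply hX _)
  rw [← integral_indicator hU.measurableSet, Measure.volume_eq_prod, integral_prod]
  swap
  · rw [← Measure.volume_eq_prod]; exact (integrable_indicator_iff hU.measurableSet).2 hi
  refine integral_eq_zero_of_ae (Filter.Eventually.of_forall fun θ => ?_)
  have hφ : Continuous fun x : ℝ => (θ, x) := by fun_prop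
  have hV := hU.preimage hφ
  have hbV : Bornology.IsBounded ((fun x : ℝ => (θ, x)) ⁻¹' U) :=
    (LipschitzWith.prod_snd.isBounded_image hb).subset fun x hx => ⟨(θ, x), hx, rfl⟩
  have := setIntegral_deriv_eq_zero hV hbV (h := fun x => X (θ, x))
    (h' := fun x => dZ X (θ, x)) (fun x hx => ?_)
    (fun x hx => h0 _ (preimage_frontier_subset_of_isOpen hU hφ hx))
  · rw [← integral_indicator hV.measurableSet] at this
    exact this
  · exact (((hX _ (hφ.closure_preimage_subset U hx)).differentiableAt
      one_ne_zero).hasFDerivAt).comp_hasDerivAt x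
        ((hasDerivAt_const x θ).prodMk (hasDerivAt_id x))

theorem dTh_dZ_comm {f : ℝ × ℝ → ℝ} (hf : ContDiff ℝ 2 f) (p : ℝ × ℝ) :
    dTh (dZ f) p = dZ (dTh f) p := by
  have hd : DifferentiableAt ℝ (fderiv ℝ f) p :=
    (hf.contDiffAt.fderiv_right (m := 1) (by norm_num)).differentiableAt one_ne_zero
  have hs : IsSymmSndFDerivAt ℝ f p := hf.contDiffAt.isSymmSndFDerivAt (by simp)
  have key : ∀ v w : ℝ × ℝ,
      fderiv ℝ (fun q => fderiv ℝ f q v) p w = fderiv ℝ (fderiv ℝ f) p w v := fun v w => by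
    rw [fderiv_clm_apply hd (differentiableAt_const v)]
    simp
  change fderiv ℝ (fun q => fderiv ℝ f q (0, 1)) p (1, 0) =
    fderiv ℝ (fun q => fderiv ℝ f q (1, 0)) p (0, 1)
  rw [key, key]
  exact hs _ _

theorem contDiff_dTh {f : ℝ × ℝ → ℝ} (hf : ContDiff ℝ 2 f) : ContDiff ℝ 1 (dTh f) :=
  (hf.fderiv_right (m := 1) (by norm_num)).clm_apply contDiff_const

theorem contDiff_dZ {f : ℝ × ℝ → ℝ} (hf : ContDiff ℝ 2 f) : ContDiff ℝ 1 (dZ f) :=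
  (hf.fderiv_right (m := 1) (by norm_num)).clm_apply contDiff_const

/-- Directional derivative of the flux `f * h + k * (f² + g²) / 2`. -/
theorem fderiv_flux {f g h k : ℝ × ℝ → ℝ} {p : ℝ × ℝ} (hf : DifferentiableAt ℝ f p)
    (hg : DifferentiableAt ℝ g p) (hh : DifferentiableAt ℝ h p) (hk : DifferentiableAt ℝ k p)
    (v : ℝ × ℝ) :
    fderiv ℝ (fun q => f q * h q + k q * (f q ^ 2 + g q ^ 2) / 2) p v =
      fderiv ℝ f p v * h p + f p * fderiv ℝ h p v +
        fderiv ℝ k p v * (f p ^ 2 + g p ^ 2) / 2 +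
        k p * (f p * fderiv ℝ f p v + g p * fderiv ℝ g p v) := by
  have h1 := (hf.hasFDerivAt.mul hh.hasFDerivAt).add
    ((hk.hasFDerivAt.mul ((hf.hasFDerivAt.pow 2).add (hg.hasFDerivAt.pow 2))).mul_const (2⁻¹))
  have h2 : HasFDerivAt (fun q => f q * h q + k q * (f q ^ 2 + g q ^ 2) / 2) _ p := h1
  rw [h2.fderiv]
  simp
  ring

/-- The pointwise Gauss–Bochner identity for the determinant of the covariant gradient of the
tangential field `(f, g)`, followed by the absorption of the cross terms. -/
theorem pointwise_normal_bound {A B kt kz s w f g ft fz gt gz Az Bt D c : ℝ} (hA : 0 < A)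
    (hB : 0 < B) (hs2 : s ^ 2 = kt * kz) (hkt : 0 ≤ kt) (hkz : 0 ≤ kz)
    (hct : kt ≤ c * s) (hcz : kz ≤ c * s) (hD : D = -(B * A * kz * kt)) :
    A * B * (s * w) * (s * w) ≤
      A * B * (s * f) * (s * f) + A * B * (s * g) * (s * g) +
      (2 * c ^ 2 + 1) * (A * B * (((B * ft + B * A * kt * w + Az * g) / (B * A)) ^ 2 +
        2 * (((A * fz - Bt * g) / (B * A) + (B * gt - Az * f) / (B * A)) / 2) ^ 2 +
        ((A * gz + B * A * kz * w + Bt * f) / (B * A)) ^ 2)) +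
      2 * (ft * gz - gt * fz + D * (f ^ 2 + g ^ 2) / 2 +
        Bt / A * (f * ft + g * gt) + Az / B * (f * fz + g * gz)) := by
  set p := (B * ft + B * A * kt * w + Az * g) / (B * A) with hp
  set q := (A * gz + B * A * kz * w + Bt * f) / (B * A) with hq
  set m := (A * fz - Bt * g) / (B * A) with hm
  set n := (B * gt - Az * f) / (B * A) with hn
  have hid : ft * gz - gt * fz + D * (f ^ 2 + g ^ 2) / 2 +
        Bt / A * (f * ft + g * gt) + Az / B * (f * fz + g * gz) =
      A * B * ((p - kt * w) * (q - kz * w) - m * n) - A * B * s ^ 2 * (f ^ 2 + g ^ 2) / 2 := by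
    rw [hp, hq, hm, hn, hD, hs2]
    field_simp
    ring
  rw [hid]
  clear_value p q m n
  have hkt2 : kt ^ 2 ≤ c ^ 2 * s ^ 2 := by
    rw [← mul_pow]; exact pow_le_pow_left₀ hkt hct 2
  have hkz2 : kz ^ 2 ≤ c ^ 2 * s ^ 2 := by
    rw [← mul_pow]; exact pow_le_pow_left₀ hkz hcz 2
  have hcross : ∀ x k : ℝ, k ^ 2 ≤ c ^ 2 * s ^ 2 →
      2 * (x * (k * w)) ≤ 2 * c ^ 2 * x ^ 2 + s ^ 2 * w ^ 2 / 2 := by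
    intro x k hk
    rcases eq_or_ne c 0 with rfl | hc
    · have : k = 0 := by nlinarith [sq_nonneg k]
      subst this
      nlinarith [mul_nonneg (sq_nonneg s) (sq_nonneg w)]
    · have hc2 : 0 < c ^ 2 := by positivity
      have h1 : k ^ 2 * w ^ 2 ≤ c ^ 2 * s ^ 2 * w ^ 2 :=
        mul_le_mul_of_nonneg_right hk (sq_nonneg w)
      have h2 := sq_nonneg (2 * c ^ 2 * x - k * w)
      have h3 : 0 ≤ c ^ 2 * (2 * c ^ 2 * x ^ 2 + s ^ 2 * w ^ 2 / 2 - 2 * (x * (k * w))) := by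
        linear_combination h1 / 2 + h2 / 2
      linarith [(mul_nonneg_iff_of_pos_left hc2).1 h3]
  have hAB : 0 < A * B := mul_pos hA hB
  have hmain : s ^ 2 * w ^ 2 ≤ (2 * c ^ 2 + 1) * (p ^ 2 + 2 * ((m + n) / 2) ^ 2 + q ^ 2) +
      2 * ((p - kt * w) * (q - kz * w) - m * n) := by
    have e : kt * w * (kz * w) = s ^ 2 * w ^ 2 := by rw [hs2]; ring
    have h1 := hcross p kz hkz2
    have h2 := hcross q kt hkt2
    have h3 : 0 ≤ c ^ 2 * (m + n) ^ 2 := by positivity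
    linear_combination h1 + h2 + h3 + sq_nonneg (p + q) + sq_nonneg (m - n) / 2 - 2 * e
  linear_combination mul_le_mul_of_nonneg_left hmain hAB.le

namespace Setup2D

theorem isBounded_E {S : Setup2D} (hS : S.Base) : Bornology.IsBounded S.E := by
  refine (Metric.isBounded_Icc ((0 : ℝ), (0 : ℝ)) (1, 1)).subset ?_
  rintro ⟨x, y⟩ ⟨hx, hy⟩
  obtain ⟨h0, -, h1⟩ := hS.1 x ⟨hx.1.le, hx.2.le⟩
  exact ⟨⟨hx.1.le, h0.trans hy.1.le⟩, ⟨hx.2.le, hy.2.le.trans h1⟩⟩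

theorem FsymSq_nonneg (S : Setup2D) (p : ℝ × ℝ) : 0 ≤ S.FsymSq p := by
  unfold FsymSq
  positivity

theorem continuousOn_FsymSq {S : Setup2D} (hS : S.Base) (hC : S.Csq) :
    ContinuousOn S.FsymSq (closure S.E) := by
  obtain ⟨-, -, -, hkt, hkz, hpos, -⟩ := hS
  obtain ⟨hA, hB, hw, hf, hg⟩ := hC
  have hne : ∀ p ∈ closure S.E, S.Az p * S.Ath p ≠ 0 := fun p hp =>
    (mul_pos (hpos p hp).2 (hpos p hp).1).ne'
  have cA := hA.continuous
  have cB := hB.continuous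
  have cw := hw.continuous
  have cf := hf.continuous
  have cg := hg.continuous
  have ckt := hkt.continuous
  have ckz := hkz.continuous
  have cAz := (contDiff_dZ hA).continuous
  have cBt := (contDiff_dTh hB).continuous
  have cft := (contDiff_dTh hf).continuous
  have cfz := (contDiff_dZ hf).continuous
  have cgt := (contDiff_dTh hg).continuous
  have cgz := (contDiff_dZ hg).continuous
  have cBA : ContinuousOn (fun p => S.Az p * S.Ath p) (closure S.E) := (cB.mul cA).continuousOn
  have c22 : ContinuousOn S.F22 (closure S.E) :=
    ContinuousOn.div (by fun_prop) cBA hne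
  have c23 : ContinuousOn S.F23 (closure S.E) :=
    ContinuousOn.div (by fun_prop) cBA hne
  have c32 : ContinuousOn S.F32 (closure S.E) :=
    ContinuousOn.div (by fun_prop) cBA hne
  have c33 : ContinuousOn S.F33 (closure S.E) :=
    ContinuousOn.div (by fun_prop) cBA hne
  exact ((c22.pow 2).add (continuousOn_const.mul (((c23.add c32).div_const 2).pow 2))).add
    (c33.pow 2)

/-- The first component of the flux whose divergence is the determinant of the covariant gradient
of the tangential part of the displacement, up to a curvature term. -/
def fluxTh (S : Setup2D) (p : ℝ × ℝ) : ℝ :=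
  S.uth p * dZ S.uz p + dTh S.Az p / S.Ath p * (S.uth p ^ 2 + S.uz p ^ 2) / 2

/-- The second component of the flux whose divergence is the determinant of the covariant gradient
of the tangential part of the displacement, up to a curvature term. -/
def fluxZ (S : Setup2D) (p : ℝ × ℝ) : ℝ :=
  S.uth p * (-dTh S.uz p) + dZ S.Ath p / S.Az p * (S.uth p ^ 2 + S.uz p ^ 2) / 2

theorem contDiffAt_fluxTh {S : Setup2D} (hC : S.Csq) {p : ℝ × ℝ} (hp : S.Ath p ≠ 0) :
    ContDiffAt ℝ 1 S.fluxTh p := by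
  obtain ⟨hA, hB, -, hf, hg⟩ := hC
  have hA := (hA.of_le (m := 1) (by norm_num)).contDiffAt (x := p)
  have hf := (hf.of_le (m := 1) (by norm_num)).contDiffAt (x := p)
  have hg' := (hg.of_le (m := 1) (by norm_num)).contDiffAt (x := p)
  exact (hf.mul (contDiff_dZ hg).contDiffAt).add
    ((((contDiff_dTh hB).contDiffAt.div hA hp).mul ((hf.pow 2).add (hg'.pow 2))).div_const 2)

theorem contDiffAt_fluxZ {S : Setup2D} (hC : S.Csq) {p : ℝ × ℝ} (hp : S.Az p ≠ 0) :
    ContDiffAt ℝ 1 S.fluxZ p := by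
  obtain ⟨hA, hB, -, hf, hg⟩ := hC
  have hB := (hB.of_le (m := 1) (by norm_num)).contDiffAt (x := p)
  have hf := (hf.of_le (m := 1) (by norm_num)).contDiffAt (x := p)
  have hg' := (hg.of_le (m := 1) (by norm_num)).contDiffAt (x := p)
  exact (hf.mul (contDiff_dTh hg).contDiffAt.neg).add
    ((((contDiff_dZ hA).contDiffAt.div hB hp).mul ((hf.pow 2).add (hg'.pow 2))).div_const 2)

/-- The divergence of the flux, computed with the Codazzi–Gauss quantity left unevaluated. -/
theorem div_flux {S : Setup2D} (hC : S.Csq) {p : ℝ × ℝ} (hAp : S.Ath p ≠ 0) (hBp : S.Az p ≠ 0) :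
    dTh S.fluxTh p + dZ S.fluxZ p =
      dTh S.uth p * dZ S.uz p - dTh S.uz p * dZ S.uth p +
        (dZ (fun q => dZ S.Ath q / S.Az q) p + dTh (fun q => dTh S.Az q / S.Ath q) p) *
          (S.uth p ^ 2 + S.uz p ^ 2) / 2 +
        dTh S.Az p / S.Ath p * (S.uth p * dTh S.uth p + S.uz p * dTh S.uz p) +
        dZ S.Ath p / S.Az p * (S.uth p * dZ S.uth p + S.uz p * dZ S.uz p) := by
  obtain ⟨hA, hB, -, hf, hg⟩ := hC
  have df := (hf.differentiable two_ne_zero) p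
  have dg := (hg.differentiable two_ne_zero) p
  have dα : DifferentiableAt ℝ (fun q => dTh S.Az q / S.Ath q) p :=
    ((contDiff_dTh hB).contDiffAt.div (hA.of_le (by norm_num)).contDiffAt hAp).differentiableAt
      one_ne_zero
  have dβ : DifferentiableAt ℝ (fun q => dZ S.Ath q / S.Az q) p :=
    ((contDiff_dZ hA).contDiffAt.div (hB.of_le (by norm_num)).contDiffAt hBp).differentiableAt
      one_ne_zero
  have dgt := ((contDiff_dTh hg).differentiable one_ne_zero) p
  have dgz := ((contDiff_dZ hg).differentiable one_ne_zero) p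
  have h1 := fderiv_flux df dg dgz dα (1, 0)
  have h2 := fderiv_flux df dg dgt.fun_neg dβ (0, 1)
  have h3 : fderiv ℝ (fun q => -dTh S.uz q) p (0, 1) = -dZ (dTh S.uz) p := by
    rw [fderiv_fun_neg]; rfl
  have h4 := dTh_dZ_comm hg p
  rw [h3, ← h4] at h2
  change dTh S.fluxTh p = _ at h1
  change dZ S.fluxZ p = _ at h2
  rw [h1, h2]
  simp only [dTh, dZ]
  ring

end Setup2D

theorem key_bound_normal_component (c a Mb : ℝ) (hc : 0 < c) (ha : 0 < a) (hMb : 0 < Mb) :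
    ∃ C : ℝ, 0 < C ∧
      ∀ S : Setup2D,
        S.Base → S.Csq → S.BZero → S.CodazziGauss → S.Comparable c →
        (∀ p ∈ closure S.E,
          a ≤ S.Ath p ∧ S.Ath p ≤ Mb ∧ a ≤ S.Az p ∧ S.Az p ≤ Mb ∧
          ‖fderiv ℝ S.Ath p‖ ≤ Mb ∧ ‖fderiv ℝ S.Az p‖ ≤ Mb ∧
          ‖fderiv ℝ (fderiv ℝ S.Ath) p‖ ≤ Mb ∧ ‖fderiv ℝ (fderiv ℝ S.Az) p‖ ≤ Mb) →
        S.nsq (fun p => Real.sqrt (S.kth p * S.kz p) * S.ut p) ≤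
          C * (S.nsq (fun p => Real.sqrt (S.kth p * S.kz p) * S.uth p) +
            S.nsq (fun p => Real.sqrt (S.kth p * S.kz p) * S.uz p) + S.nF) := by
  refine ⟨2 * c ^ 2 + 1, by positivity, fun S hS hC h0 hG hcmp _ => ?_⟩
  have hbE := Setup2D.isBounded_E hS
  have hF := Setup2D.continuousOn_FsymSq hS hC
  have hpos := hS.2.2.2.2.2.1
  have hAB : ∀ p ∈ closure S.E, 0 < S.Ath p * S.Az p := fun p hp =>
    mul_pos (hpos p hp).1 (hpos p hp).2
  have cA := hC.1.continuous
  have cB := hC.2.1.continuous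
  have cs : Continuous fun p => √(S.kth p * S.kz p) :=
    (hS.2.2.2.1.continuous.mul hS.2.2.2.2.1.continuous).sqrt
  -- the weighted square of `√K v`
  let H : (ℝ × ℝ → ℝ) → ℝ × ℝ → ℝ := fun v p =>
    S.Ath p * S.Az p * (√(S.kth p * S.kz p) * v p) * (√(S.kth p * S.kz p) * v p)
  have hHnn : ∀ v, ∀ p ∈ closure S.E, 0 ≤ H v p := fun v p hp => by
    have := mul_nonneg (hAB p hp).le (mul_self_nonneg (√(S.kth p * S.kz p) * v p))
    simpa only [H, mul_assoc] using this
  have hHc : ∀ v, Continuous v → Continuous (H v) := fun v hv => by fun_prop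
  let N : ℝ × ℝ → ℝ := fun p => S.Ath p * S.Az p * S.FsymSq p
  have hNnn : ∀ p ∈ closure S.E, 0 ≤ N p := fun p hp =>
    mul_nonneg (hAB p hp).le (S.FsymSq_nonneg p)
  have hNc : ContinuousOn N (closure S.E) := (cA.mul cB).continuousOn.mul hF
  set U := interior S.E
  have hUo : IsOpen U := isOpen_interior
  have hUE : U ⊆ S.E := interior_subset
  have hUcl : closure U ⊆ closure S.E := closure_mono hUE
  have hbU : Bornology.IsBounded U := hbE.subset hUE
  have hUfr : frontier U ⊆ frontier S.E := frontier_interior_subset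
  have hmono : ∀ f : ℝ × ℝ → ℝ, ContinuousOn f (closure S.E) → (∀ p ∈ closure S.E, 0 ≤ f p) →
      ∫ p in U, f p ≤ ∫ p in S.E, f p := fun f hf hnn =>
    setIntegral_mono_set (integrableOn_of_continuousOn_closure hbE hf)
      (ae_mono (Measure.restrict_mono subset_closure le_rfl)
        ((ae_restrict_iff' isClosed_closure.measurableSet).2
          (Filter.Eventually.of_forall hnn)))
      (Filter.Eventually.of_forall hUE)
  have cw := hC.2.2.1.continuous
  have cf := hC.2.2.2.1.continuous
  have cg := hC.2.2.2.2.continuous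
  have hleft : ∫ p in S.E, H S.ut p ≤ ∫ p in U, H S.ut p := by
    have h1 : ∫ p in S.E, H S.ut p ≤ ∫ p in closure S.E, H S.ut p :=
      setIntegral_mono_set
        ((hHc _ cw).continuousOn.integrableOn_compact hbE.isCompact_closure)
        ((ae_restrict_iff' isClosed_closure.measurableSet).2
          (Filter.Eventually.of_forall (hHnn _)))
        (Filter.Eventually.of_forall subset_closure)
    refine h1.trans_eq (setIntegral_eq_of_subset_of_forall_sdiff_eq_zero
      isClosed_closure.measurableSet (hUE.trans subset_closure) fun p hp => ?_)
    simp only [H, (h0 p hp).1, mul_zero]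
  have hXc : ∀ p ∈ closure U, ContDiffAt ℝ 1 S.fluxTh p := fun p hp =>
    Setup2D.contDiffAt_fluxTh hC (hpos p (hUcl hp)).1.ne'
  have hYc : ∀ p ∈ closure U, ContDiffAt ℝ 1 S.fluxZ p := fun p hp =>
    Setup2D.contDiffAt_fluxZ hC (hpos p (hUcl hp)).2.ne'
  have hX0 := setIntegral_dTh_eq_zero hUo hbU hXc fun p hp => by
    simp [Setup2D.fluxTh, h0 p (hUfr hp)]
  have hY0 := setIntegral_dZ_eq_zero hUo hbU hYc fun p hp => by
    simp [Setup2D.fluxZ, h0 p (hUfr hp)]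
  have iX : IntegrableOn (dTh S.fluxTh) U :=
    integrableOn_of_continuousOn_closure hbU (continuousOn_fderiv_apply hXc _)
  have iY : IntegrableOn (dZ S.fluxZ) U :=
    integrableOn_of_continuousOn_closure hbU (continuousOn_fderiv_apply hYc _)
  have iH : ∀ v, Continuous v → IntegrableOn (H v) U := fun v hv =>
    integrableOn_of_continuousOn_closure hbU (hHc v hv).continuousOn
  have iN : IntegrableOn N U := integrableOn_of_continuousOn_closure hbU (hNc.mono hUcl)
  have hpt : ∀ p ∈ U, H S.ut p ≤ H S.uth p + H S.uz p + (2 * c ^ 2 + 1) * N p +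
      2 * (dTh S.fluxTh p + dZ S.fluxZ p) := fun p hp => by
    have hpE := hUE hp
    obtain ⟨hAp, hBp⟩ := hpos p (subset_closure hpE)
    obtain ⟨hkt, hkz, -, hct, -, hcz⟩ := hcmp p hpE
    rw [Setup2D.div_flux hC hAp.ne' hBp.ne']
    exact pointwise_normal_bound hAp hBp (Real.sq_sqrt (mul_nonneg hkt hkz)) hkt hkz hct hcz
      (hG p hpE)
  have hint : ∫ p in U, H S.ut p ≤ (∫ p in U, H S.uth p) + (∫ p in U, H S.uz p) +
      (2 * c ^ 2 + 1) * ∫ p in U, N p := by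
    have i1 : IntegrableOn (fun p => H S.uth p + H S.uz p) U := (iH _ cf).add (iH _ cg)
    have i2 : IntegrableOn (fun p => (2 * c ^ 2 + 1) * N p) U := iN.const_mul _
    have i3 : IntegrableOn (fun p => H S.uth p + H S.uz p + (2 * c ^ 2 + 1) * N p) U := i1.add i2
    have i4 : IntegrableOn (fun p => 2 * (dTh S.fluxTh p + dZ S.fluxZ p)) U :=
      (iX.add iY).const_mul 2
    have h1 := setIntegral_mono_on (iH _ cw) (i3.add i4) hUo.measurableSet hpt
    rwa [integral_add' i3 i4, integral_add i1 i2, integral_add (iH _ cf) (iH _ cg),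
      integral_const_mul, integral_const_mul, integral_add iX iY, hX0, hY0, add_zero, mul_zero,
      add_zero] at h1
  have hf := hmono _ (hHc _ cf).continuousOn (hHnn _)
  have hg := hmono _ (hHc _ cg).continuousOn (hHnn _)
  have hN := hmono _ hNc hNnn
  have hf0 : 0 ≤ ∫ p in U, H S.uth p := setIntegral_nonneg hUo.measurableSet fun p hp =>
    hHnn _ p (subset_closure (hUE hp))
  have hg0 : 0 ≤ ∫ p in U, H S.uz p := setIntegral_nonneg hUo.measurableSet fun p hp =>
    hHnn _ p (subset_closure (hUE hp))
  change ∫ p in S.E, H S.ut p ≤ (2 * c ^ 2 + 1) *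
    ((∫ p in S.E, H S.uth p) + (∫ p in S.E, H S.uz p) + ∫ p in S.E, N p)
  have hc2 := sq_nonneg c
  nlinarith [mul_nonneg hc2 (hf0.trans hf), mul_nonneg hc2 (hg0.trans hg),
    mul_le_mul_of_nonneg_left hN (by positivity : 0 ≤ 2 * c ^ 2 + 1)]
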